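/- Let G be a finite abelian group that is not an elementary abelian 2-group (i.e. G has an element of order greater than 2), k a field whose characteristic does not divide |G|, and V a faithful finite-dimensional representation of G over k. Then γ^r(G,V) ≥ 3. -/

import Mathlib

open MvPolynomial

noncomputable section

variable {k : Type} [Field k] {N : ℕ} {G : Type}

def mAct (M : Matrix (Fin N) (Fin N) k) :
    MvPolynomial (Fin N) k →ₐ[k] MvPolynomial (Fin N) k :=
  aeval fun i => ∑ j, C (M i j) * X j

lemma mAct_comp (A B : Matrix (Fin N) (Fin N) k) :
    (mAct A).comp (mAct B) = mAct (B * A) := by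
  apply MvPolynomial.algHom_ext
  intro i
  simp only [mAct, AlgHom.comp_apply, aeval_X, map_sum, map_mul, aeval_C, algebraMap_eq,
    Finset.mul_sum, Matrix.mul_apply, Finset.sum_mul]
  rw [Finset.sum_comm]
  simp [mul_assoc]

lemma mAct_one : mAct (1 : Matrix (Fin N) (Fin N) k) = AlgHom.id k _ := by
  apply MvPolynomial.algHom_ext
  intro i
  simp [mAct, Matrix.one_apply, ite_mul, apply_ite C]

def mEquiv (M : GL (Fin N) k) :
    MvPolynomial (Fin N) k ≃ₐ[k] MvPolynomial (Fin N) k :=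
  AlgEquiv.ofAlgHom (mAct (M : Matrix (Fin N) (Fin N) k))
    (mAct ((M⁻¹ : GL (Fin N) k) : Matrix (Fin N) (Fin N) k))
    (by rw [mAct_comp, Units.inv_mul, mAct_one])
    (by rw [mAct_comp, Units.mul_inv, mAct_one])

def fAct (M : GL (Fin N) k) :
    FractionRing (MvPolynomial (Fin N) k) ≃+* FractionRing (MvPolynomial (Fin N) k) :=
  IsFractionRing.ringEquivOfRingEquiv (mEquiv M).toRingEquiv

/-- `f` is an invariant rational function for the linear action `ρ`. -/
def IsInv (ρ : G → GL (Fin N) k) (f : FractionRing (MvPolynomial (Fin N) k)) : Prop :=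
  ∀ g, fAct (ρ g) f = f

/-- `f`, written as a quotient `f₁/f₂` of coprime polynomials, has
`deg f = deg f₁ + deg f₂ ≤ d`. -/
def RDegLE (f : FractionRing (MvPolynomial (Fin N) k)) (d : ℕ) : Prop :=
  ∃ f₁ f₂ : MvPolynomial (Fin N) k, f₂ ≠ 0 ∧
    (∀ p : MvPolynomial (Fin N) k, p ∣ f₁ → p ∣ f₂ → IsUnit p) ∧
    f = algebraMap (MvPolynomial (Fin N) k) (FractionRing (MvPolynomial (Fin N) k)) f₁ /
        algebraMap (MvPolynomial (Fin N) k) (FractionRing (MvPolynomial (Fin N) k)) f₂ ∧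
    f₁.totalDegree + f₂.totalDegree ≤ d

/-- `f` is (the image in `k(V)` of) a polynomial of degree at most `d`. -/
def PDegLE (f : FractionRing (MvPolynomial (Fin N) k)) (d : ℕ) : Prop :=
  ∃ p : MvPolynomial (Fin N) k, p.totalDegree ≤ d ∧
    f = algebraMap (MvPolynomial (Fin N) k) (FractionRing (MvPolynomial (Fin N) k)) p

/-- `β^r(G,V)`: the least `d` such that the invariant rational functions of degree at most `d`
generate the invariant field over `k`. -/
def betaR (ρ : G → GL (Fin N) k) : ℕ :=
  sInf {d : ℕ | ∀ f, IsInv ρ f →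
    f ∈ IntermediateField.adjoin k {h | IsInv ρ h ∧ RDegLE h d}}

/-- `β(G,V)`: the least `d` such that the invariant polynomials of degree at most `d`
generate the invariant field over `k`. -/
def betaP (ρ : G → GL (Fin N) k) : ℕ :=
  sInf {d : ℕ | ∀ f, IsInv ρ f →
    f ∈ IntermediateField.adjoin k {h | IsInv ρ h ∧ PDegLE h d}}

/-- `γ^r(G,V)`: the least `d` such that the invariant rational functions of degree at most `d`
contain a transcendence basis for the invariant field over `k`. -/
def gammaR (ρ : G → GL (Fin N) k) : ℕ :=
  sInf {d : ℕ | ∃ s : Set (FractionRing (MvPolynomial (Fin N) k)),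
    (∀ f ∈ s, IsInv ρ f ∧ RDegLE f d) ∧
    AlgebraicIndependent k ((↑) : s → FractionRing (MvPolynomial (Fin N) k)) ∧
    ∀ f, IsInv ρ f → IsAlgebraic (IntermediateField.adjoin k s) f}

/-- `γ(G,V)`: the least `d` such that the invariant polynomials of degree at most `d`
contain a transcendence basis for the invariant field over `k`. -/
def gammaP (ρ : G → GL (Fin N) k) : ℕ :=
  sInf {d : ℕ | ∃ s : Set (FractionRing (MvPolynomial (Fin N) k)),
    (∀ f ∈ s, IsInv ρ f ∧ PDegLE f d) ∧
    AlgebraicIndependent k ((↑) : s → FractionRing (MvPolynomial (Fin N) k)) ∧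
    ∀ f, IsInv ρ f → IsAlgebraic (IntermediateField.adjoin k s) f}

/-- The character `χ : G → Lˣ` occurs in the base change to `L` of the representation `ρ`,
i.e. its eigenspace in `L ⊗ V` is nonzero. -/
def Occurs {L : Type} [Field L] [Algebra k L] [Monoid G] (ρ : G → GL (Fin N) k)
    (χ : G →* Lˣ) : Prop :=
  ∃ v : Fin N → L, v ≠ 0 ∧
    ∀ g, ((ρ g : Matrix (Fin N) (Fin N) k).map (algebraMap k L)).mulVec v = (χ g : L) • v


lemma aux_monomial (s : Fin N →₀ ℕ) (hs : s.sum (fun _ e => e) ≤ 2) :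
    s = 0 ∨ (∃ i, s = Finsupp.single i 1) ∨
      ∃ i j, s = Finsupp.single i 1 + Finsupp.single j 1 := by
  classical
  have hc : (Finsupp.toMultiset s).card ≤ 2 := by
    rw [Finsupp.card_toMultiset]; exact hs
  have key : ∀ m : Multiset (Fin N), Finsupp.toMultiset s = m → s = Multiset.toFinsupp m := by
    intro m hm
    rw [← hm, Finsupp.toMultiset_toFinsupp]
  interval_cases h : (Finsupp.toMultiset s).card
  · left
    have := key 0 (Multiset.card_eq_zero.mp h)
    simpa using this
  · right; left
    obtain ⟨a, ha⟩ := Multiset.card_eq_one.mp h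
    exact ⟨a, by simpa using key _ ha⟩
  · right; right
    obtain ⟨a, b, ha⟩ := Multiset.card_eq_two.mp h
    refine ⟨a, b, ?_⟩
    have := key _ ha
    rw [this, show ({a, b} : Multiset (Fin N)) = {a} + {b} from rfl, map_add]
    simp

lemma aux_monomial1 (s : Fin N →₀ ℕ) (hs : s.sum (fun _ e => e) ≤ 1) :
    s = 0 ∨ (∃ i, s = Finsupp.single i 1) := by
  rcases aux_monomial s (hs.trans (by norm_num)) with h | h | ⟨i, j, h⟩
  · exact Or.inl h
  · exact Or.inr h
  · exfalso
    have h2 : s.degree = 2 := by rw [h, map_add]; simp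
    have : s.degree = s.sum (fun _ e => e) := by rw [Finsupp.degree_apply]; rfl
    omega

lemma aux_quad (f : MvPolynomial (Fin N) k) (hf : f.totalDegree ≤ 2) (t : k)
    (x y : Fin N → k) :
    eval (t • x + y) f = eval (t • x) f + eval y f - eval 0 f
      + t * (eval (x + y) f - eval x f - eval y f + eval 0 f) := by
  simp only [MvPolynomial.eval_eq]
  simp only [← Finset.sum_add_distrib, ← Finset.sum_sub_distrib, Finset.mul_sum]
  refine Finset.sum_congr rfl fun s hs => ?_
  have h := (le_totalDegree hs).trans hf
  have e : ∀ z : Fin N → k, ∏ i ∈ s.support, z i ^ s i = eval z (monomial s 1) := by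
    intro z; rw [eval_monomial, one_mul]; rfl
  simp only [e]
  rcases aux_monomial s h with h | ⟨i, h⟩ | ⟨i, j, h⟩ <;> subst h
  · simp
  · have : (monomial (Finsupp.single i 1) (1:k)) = X i := rfl
    simp [this]; ring
  · have : (monomial (Finsupp.single i 1 + Finsupp.single j 1) (1:k)) = X i * X j := by
      simp [X, monomial_mul]
    simp [this]; ring

lemma aux_lin (f : MvPolynomial (Fin N) k) (hf : f.totalDegree ≤ 1) (t : k)
    (x y : Fin N → k) :
    eval (t • x + y) f = t * eval x f + eval y f - t * eval 0 f := by
  simp only [MvPolynomial.eval_eq]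
  simp only [Finset.mul_sum]
  simp only [← Finset.sum_add_distrib, ← Finset.sum_sub_distrib]
  refine Finset.sum_congr rfl fun s hs => ?_
  have h := (le_totalDegree hs).trans hf
  have e : ∀ z : Fin N → k, ∏ i ∈ s.support, z i ^ s i = eval z (monomial s 1) := by
    intro z; rw [eval_monomial, one_mul]; rfl
  simp only [e]
  rcases aux_monomial1 s h with h | ⟨i, h⟩ <;> subst h
  · simp
  · have : (monomial (Finsupp.single i 1) (1:k)) = X i := rfl
    simp [this]; ring

lemma aux_eval (M : Matrix (Fin N) (Fin N) k) (x : Fin N → k) (f : MvPolynomial (Fin N) k) :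
    eval x (mAct M f) = eval (M.mulVec x) f := by
  have : (MvPolynomial.aeval x : MvPolynomial (Fin N) k →ₐ[k] k).comp (mAct M)
      = MvPolynomial.aeval (M.mulVec x) := by
    apply MvPolynomial.algHom_ext
    intro i
    simp [mAct, Matrix.mulVec, dotProduct]
  have h := DFunLike.congr_fun this f
  simpa [MvPolynomial.aeval_eq_eval] using h

lemma aux_deg (M : Matrix (Fin N) (Fin N) k) (f : MvPolynomial (Fin N) k) :
    (mAct M f).totalDegree ≤ f.totalDegree := by
  rw [mAct, aeval_def, eval₂_eq]
  refine totalDegree_finsetSum_le fun s hs => ?_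
  refine (totalDegree_mul _ _).trans ?_
  rw [algebraMap_eq, totalDegree_C, zero_add]
  refine (totalDegree_finsetProd _ _).trans ?_
  refine le_trans ?_ (le_totalDegree hs)
  refine Finset.sum_le_sum fun i _ => ?_
  refine (totalDegree_pow _ _).trans ?_
  have : (∑ j, C (M i j) * X j : MvPolynomial (Fin N) k).totalDegree ≤ 1 := by
    refine totalDegree_finsetSum_le fun j _ => ?_
    refine (totalDegree_mul _ _).trans ?_
    simp
  nlinarith

lemma aux_map {K : Type} [Field K] (φ : k →+* K) (M : Matrix (Fin N) (Fin N) k)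
    (f : MvPolynomial (Fin N) k) :
    map φ (mAct M f) = mAct (M.map φ) (map φ f) := by
  induction f using MvPolynomial.induction_on with
  | C a => simp [mAct]
  | add p q hp hq => simp [hp, hq]
  | mul_X p i hp => rw [map_mul, map_mul, hp, map_mul, map_mul]; simp [mAct]

/-- the key identity -/
lemma aux_key [Infinite k] (A B : Matrix (Fin N) (Fin N) k) (hAB : A * B = 1) (t c : k)
    (f₁ f₂ : MvPolynomial (Fin N) k) (h1 : f₁ ≠ 0) (h2 : f₂ ≠ 0)
    (hd : f₁.totalDegree + f₂.totalDegree ≤ 2)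
    (e1 : mAct A f₁ = C c * f₁) (e2 : mAct A f₂ = C c * f₂) :
    mAct (t • 1 + A) f₁ * mAct (t • 1 + B) f₂ = mAct (t • 1 + A) f₂ * mAct (t • 1 + B) f₁ := by
  have hBA : B * A = 1 := by rwa [mul_eq_one_comm]
  have ev : ∀ f : MvPolynomial (Fin N) k, mAct A f = C c * f → ∀ x,
      eval (A.mulVec x) f = c * eval x f := by
    intro f hf x
    rw [← aux_eval, hf]; simp
  have hAx : ∀ x, A.mulVec (B.mulVec x) = x := by
    intro x; rw [Matrix.mulVec_mulVec, hAB, Matrix.one_mulVec]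
  by_cases hc : c = 1
  · have : ∀ f : MvPolynomial (Fin N) k, mAct A f = C c * f → f.totalDegree ≤ 2 →
        mAct (t • 1 + A) f = mAct (t • 1 + B) f := by
      intro f hf hdf
      apply MvPolynomial.funext
      intro x
      have q := ev f hf
      simp only [hc, one_mul] at q
      simp only [aux_eval, Matrix.add_mulVec, Matrix.smul_mulVec, Matrix.one_mulVec]
      rw [aux_quad f hdf, aux_quad f hdf]
      have r1 : eval (B.mulVec x) f = eval x f := by rw [← q, hAx]
      have r2 : eval (x + B.mulVec x) f = eval (x + A.mulVec x) f := by
        rw [← q, Matrix.mulVec_add, hAx, add_comm]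
      rw [r1, r2, q]
    rw [this f₁ e1 (by omega), this f₂ e2 (by omega), mul_comm]
  · have nc : ∀ f : MvPolynomial (Fin N) k, f ≠ 0 → mAct A f = C c * f →
        1 ≤ f.totalDegree := by
      intro f hf he
      by_contra hlt
      have h0 : f.totalDegree = 0 := by omega
      rw [totalDegree_eq_zero_iff_eq_C] at h0
      have hco : coeff 0 f ≠ 0 := by
        intro hh; rw [hh] at h0; exact hf (by simpa using h0)
      have := ev f he 0
      rw [Matrix.mulVec_zero] at this
      have h3 : eval 0 f ≠ 0 := by rw [h0]; simpa using hco
      exact hc (mul_right_cancel₀ h3 (by rw [← this, one_mul]))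
    have n1 := nc _ h1 e1
    have n2 := nc _ h2 e2
    have c0 : c ≠ 0 := by
      rintro rfl
      apply h1
      apply MvPolynomial.funext
      intro x
      have := ev _ e1 (B.mulVec x)
      rw [hAx] at this
      simpa using this
    have res : ∀ f : MvPolynomial (Fin N) k, mAct A f = C c * f → f.totalDegree ≤ 1 → ∀ x,
        eval x (mAct (t • 1 + A) f) = (t + c) * eval x f ∧
        eval x (mAct (t • 1 + B) f) = (t + c⁻¹) * eval x f := by
      intro f hf hdf x
      have q := ev f hf
      have z : eval 0 f = 0 := by
        have := q 0
        rw [Matrix.mulVec_zero] at this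
        by_contra hne
        exact hc (mul_right_cancel₀ hne (by rw [← this, one_mul]))
      have r1 : eval (B.mulVec x) f = c⁻¹ * eval x f := by
        have := q (B.mulVec x)
        rw [hAx] at this
        rw [this]; field_simp
      simp only [aux_eval, Matrix.add_mulVec, Matrix.smul_mulVec, Matrix.one_mulVec]
      rw [aux_lin f hdf, aux_lin f hdf, z, r1, q]
      constructor <;> ring
    apply MvPolynomial.funext
    intro x
    rw [map_mul, map_mul, (res f₁ e1 (by omega) x).1, (res f₁ e1 (by omega) x).2,
      (res f₂ e2 (by omega) x).1, (res f₂ e2 (by omega) x).2]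
    ring


lemma fAct_algebraMap (M : GL (Fin N) k) (p : MvPolynomial (Fin N) k) :
    fAct M (algebraMap _ (FractionRing (MvPolynomial (Fin N) k)) p) =
      algebraMap _ _ (mAct (M : Matrix (Fin N) (Fin N) k) p) :=
  IsFractionRing.ringEquivOfRingEquiv_algebraMap _ _

/-- the action as a group homomorphism -/
def actHom [CommGroup G] (ρ : G →* GL (Fin N) k) :
    G →* RingAut (FractionRing (MvPolynomial (Fin N) k)) where
  toFun g := fAct (ρ g)
  map_one' := by
    refine RingEquiv.ext fun x => ?_
    obtain ⟨a, b, hb, rfl⟩ := IsFractionRing.div_surjective (A := MvPolynomial (Fin N) k) x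
    rw [map_div₀, fAct_algebraMap, fAct_algebraMap, map_one, Units.val_one, mAct_one]
    rfl
  map_mul' g h := by
    have e : ∀ p, mAct (ρ (g * h) : Matrix (Fin N) (Fin N) k) p
        = mAct (ρ g : Matrix (Fin N) (Fin N) k) (mAct (ρ h : Matrix (Fin N) (Fin N) k) p) := by
      intro p
      rw [← AlgHom.comp_apply, mAct_comp, mul_comm g h, map_mul]; rfl
    refine RingEquiv.ext fun x => ?_
    obtain ⟨a, b, hb, rfl⟩ := IsFractionRing.div_surjective (A := MvPolynomial (Fin N) k) x
    rw [RingAut.mul_apply]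
    simp only [map_div₀, fAct_algebraMap, e]

lemma aux_fixed [CommGroup G] [Fintype G] (ρ : G →* GL (Fin N) k) :
    ∃ F : Subfield (FractionRing (MvPolynomial (Fin N) k)),
      (∀ x, x ∈ F ↔ IsInv (fun g => ρ g) x) ∧
      ∀ x : FractionRing (MvPolynomial (Fin N) k), IsIntegral F x := by
  letI : MulSemiringAction G (FractionRing (MvPolynomial (Fin N) k)) :=
    MulSemiringAction.compHom _ (actHom ρ)
  refine ⟨FixedPoints.subfield G (FractionRing (MvPolynomial (Fin N) k)), fun x => Iff.rfl, fun x =>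
    FixedPoints.isIntegral G (FractionRing (MvPolynomial (Fin N) k)) x⟩

lemma aux_trdeg : Algebra.trdeg k (FractionRing (MvPolynomial (Fin N) k)) < Cardinal.aleph0 := by
  have : Algebra.IsAlgebraic (MvPolynomial (Fin N) k) (FractionRing (MvPolynomial (Fin N) k)) :=
    IsLocalization.isAlgebraic _ (nonZeroDivisors (MvPolynomial (Fin N) k))
  rw [← trdeg_add_eq k (MvPolynomial (Fin N) k), MvPolynomial.trdeg_of_isDomain,
    trdeg_eq_zero]
  simp

lemma aux_nonempty [CommGroup G] [Fintype G] (ρ : G →* GL (Fin N) k) :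
    {d : ℕ | ∃ s : Set (FractionRing (MvPolynomial (Fin N) k)),
    (∀ f ∈ s, IsInv (fun g => ρ g) f ∧ RDegLE f d) ∧
    AlgebraicIndependent k ((↑) : s → FractionRing (MvPolynomial (Fin N) k)) ∧
    ∀ f, IsInv (fun g => ρ g) f → IsAlgebraic (IntermediateField.adjoin k s) f}.Nonempty := by
  obtain ⟨F, hF, hint⟩ := aux_fixed ρ
  let S := Algebra.adjoin k {x | IsInv (fun g => ρ g) x}
  have hFS : ∀ x : F, F.subtype x ∈ S := fun x => Algebra.subset_adjoin ((hF _).1 x.2)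
  letI : Algebra F S := (F.subtype.codRestrict S hFS).toAlgebra
  haveI : IsScalarTower F S (FractionRing (MvPolynomial (Fin N) k)) :=
    IsScalarTower.of_algebraMap_eq fun _ => rfl
  haveI : Algebra.IsAlgebraic S (FractionRing (MvPolynomial (Fin N) k)) :=
    ⟨fun x => ((hint x).tower_top (A := S)).isAlgebraic⟩
  obtain ⟨s, hs, hb⟩ := exists_isTranscendenceBasis_subset (R := k) {x | IsInv (fun g => ρ g) x}
  have hfin : s.Finite := by
    have := hb.cardinalMk_eq_trdeg
    rw [← Set.finite_coe_iff, ← Cardinal.lt_aleph0_iff_finite, this]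
    exact aux_trdeg
  have hdeg : ∀ f : FractionRing (MvPolynomial (Fin N) k), ∃ d, RDegLE f d := by
    intro f
    obtain ⟨a, b, hab, rfl⟩ := IsFractionRing.exists_reduced_fraction (MvPolynomial (Fin N) k) f
    refine ⟨_, a, b, nonZeroDivisors.ne_zero b.2, fun p h1 h2 => hab h1 h2, ?_, le_rfl⟩
    rw [IsFractionRing.mk'_eq_div]
  choose D hD using hdeg
  obtain ⟨m, hm⟩ := (hfin.image D).bddAbove
  refine ⟨m, s, fun f hf => ⟨hs hf, ?_⟩, hb.1, fun f _ => ?_⟩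
  · obtain ⟨f₁, f₂, h1, h2, h3, h4⟩ := hD f
    exact ⟨f₁, f₂, h1, h2, h3, h4.trans (hm ⟨f, hf, rfl⟩)⟩
  · have := hb.isAlgebraic_field
    rw [Subtype.range_coe] at this
    exact this.isAlgebraic f

lemma aux_alg [CommGroup G] [Fintype G] (ρ : G →* GL (Fin N) k)
    (E : IntermediateField k (FractionRing (MvPolynomial (Fin N) k)))
    (hE : ∀ f, IsInv (fun g => ρ g) f → IsAlgebraic E f)
    (x : FractionRing (MvPolynomial (Fin N) k)) : IsAlgebraic E x := by
  obtain ⟨F, hF, hint⟩ := aux_fixed ρ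
  let S := algebraicClosure E (FractionRing (MvPolynomial (Fin N) k))
  have hFS : ∀ x : F, F.subtype x ∈ S := fun x => by
    rw [mem_algebraicClosure_iff]
    exact hE _ ((hF _).1 x.2)
  letI : Algebra F S := (F.subtype.codRestrict S hFS).toAlgebra
  haveI : IsScalarTower F S (FractionRing (MvPolynomial (Fin N) k)) :=
    IsScalarTower.of_algebraMap_eq fun _ => rfl
  have h := (hint x).tower_top (A := S)
  exact (isIntegral_trans (R := E) x h).isAlgebraic

/-- eigenvector property -/
lemma aux_semi (M : GL (Fin N) k) (f₁ f₂ : MvPolynomial (Fin N) k) (h1 : f₁ ≠ 0) (h2 : f₂ ≠ 0)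
    (hcop : ∀ p : MvPolynomial (Fin N) k, p ∣ f₁ → p ∣ f₂ → IsUnit p)
    (hinv : fAct M (algebraMap _ (FractionRing (MvPolynomial (Fin N) k)) f₁ /
        algebraMap _ (FractionRing (MvPolynomial (Fin N) k)) f₂) =
        (algebraMap _ (FractionRing (MvPolynomial (Fin N) k)) f₁ /
        algebraMap _ (FractionRing (MvPolynomial (Fin N) k)) f₂)) :
    ∃ c : k, mAct (M : Matrix (Fin N) (Fin N) k) f₁ = C c * f₁ ∧
      mAct (M : Matrix (Fin N) (Fin N) k) f₂ = C c * f₂ := by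
  have inj : Function.Injective (algebraMap (MvPolynomial (Fin N) k)
      (FractionRing (MvPolynomial (Fin N) k))) := IsFractionRing.injective _ _
  have ne : ∀ p, p ≠ 0 → mAct (M : Matrix (Fin N) (Fin N) k) p ≠ 0 := by
    intro p hp h
    exact hp ((map_eq_zero_iff (mEquiv M) (mEquiv M).injective).1 h)
  simp only [fAct, map_div₀, IsFractionRing.ringEquivOfRingEquiv_algebraMap] at hinv
  change algebraMap _ _ (mAct (M : Matrix (Fin N) (Fin N) k) f₁) /
    algebraMap _ _ (mAct (M : Matrix (Fin N) (Fin N) k) f₂) = _ at hinv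
  rw [div_eq_div_iff (by simpa using ne f₂ h2) (by simpa using h2), ← map_mul, ← map_mul] at hinv
  have hinv := inj hinv
  have hd : f₁ ∣ mAct (M : Matrix (Fin N) (Fin N) k) f₁ :=
    IsRelPrime.dvd_of_dvd_mul_right (z := f₂) (fun p a b => hcop p a b) (hinv ▸ dvd_mul_right _ _)
  obtain ⟨h, hh⟩ := hd
  have h0 : h ≠ 0 := by
    rintro rfl
    exact ne f₁ h1 (by simpa using hh)
  have hdeg := aux_deg (M : Matrix (Fin N) (Fin N) k) f₁
  rw [hh, totalDegree_mul_of_isDomain h1 h0] at hdeg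
  have h3 : h.totalDegree = 0 := by omega
  rw [totalDegree_eq_zero_iff_eq_C] at h3
  refine ⟨coeff 0 h, ?_, ?_⟩
  · rw [← h3, hh, mul_comm]
  · rw [← h3]
    apply mul_left_cancel₀ h1
    rw [← hinv, hh]; ring

lemma aux_inf {K : Type} [Field K] [Infinite K] (A B : Matrix (Fin N) (Fin N) K) :
    {t : K | IsUnit (t • 1 + A) ∧ IsUnit (t • 1 + B)}.Infinite := by
  have fin : ∀ A : Matrix (Fin N) (Fin N) K, {t : K | ¬ IsUnit (t • 1 + A)}.Finite := by
    intro A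
    classical
    refine ((-A).charpoly.roots.toFinset.finite_toSet).subset fun t ht => ?_
    simp only [Finset.mem_coe, Multiset.mem_toFinset]
    rw [Polynomial.mem_roots (Matrix.charpoly_monic _).ne_zero, Polynomial.IsRoot,
      Matrix.eval_charpoly]
    rw [Set.mem_ofPred_eq, Matrix.isUnit_iff_isUnit_det, isUnit_iff_ne_zero, not_not] at ht
    rw [← ht, sub_neg_eq_add, Matrix.smul_one_eq_diagonal, Matrix.scalar_apply]
  have := ((fin A).union (fin B)).infinite_compl
  refine this.mono fun t ht => ?_
  simpa [not_or] using ht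

lemma aux_degmap {K : Type} [Field K] (φ : k →+* K) (f : MvPolynomial (Fin N) k) :
    (map φ f).totalDegree ≤ f.totalDegree :=
  Finset.sup_mono (support_map_subset _ _)

lemma aux_main [CommGroup G] [Fintype G] (hG : ∃ g : G, 2 < orderOf g)
    (ρ : G →* GL (Fin N) k) (hfaithful : Function.Injective ρ) 
    (s : Set (FractionRing (MvPolynomial (Fin N) k)))
    (hs : ∀ f ∈ s, IsInv (fun g => ρ g) f ∧ RDegLE f 2)
    (halg : ∀ f, IsInv (fun g => ρ g) f → IsAlgebraic (IntermediateField.adjoin k s) f) :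
    False := by
  obtain ⟨g, hg⟩ := hG
  let a : k →+* (AlgebraicClosure k) := algebraMap k (AlgebraicClosure k)
  have ha : Function.Injective a := a.injective
  let A : Matrix (Fin N) (Fin N) (AlgebraicClosure k) := (ρ g : Matrix (Fin N) (Fin N) k).map a
  let B : Matrix (Fin N) (Fin N) (AlgebraicClosure k) := ((ρ g)⁻¹ : GL (Fin N) k).val.map a
  have hAB : A * B = 1 := by
    rw [← Matrix.map_mul, Units.mul_inv, Matrix.map_one _ (map_zero a) (map_one a)]
  have hBA : B * A = 1 := by rwa [mul_eq_one_comm]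
  have : Infinite (AlgebraicClosure k) := inferInstance
  let T : Set (AlgebraicClosure k) := {t : (AlgebraicClosure k) | IsUnit (t • 1 + A) ∧ IsUnit (t • 1 + B)}
  have hT : T.Infinite := aux_inf A B
  let U : (AlgebraicClosure k) → Matrix (Fin N) (Fin N) (AlgebraicClosure k) := fun t => (t • 1 + A) * (t • 1 + B)⁻¹
  have hU : ∀ t ∈ T, U t * (t • 1 + B) = t • 1 + A := by
    intro t ht
    have := (Matrix.isUnit_iff_isUnit_det _).1 ht.2
    simp only [U]
    rw [mul_assoc, Matrix.nonsing_inv_mul _ this, mul_one]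
  have minj : ∀ M : Matrix (Fin N) (Fin N) (AlgebraicClosure k), IsUnit M → Function.Injective (mAct M) := by
    rintro M ⟨M, rfl⟩
    exact (mEquiv M).injective
  let ψ : (AlgebraicClosure k) → (MvPolynomial (Fin N) k) →+* (FractionRing (MvPolynomial (Fin N) (AlgebraicClosure k))) := fun t =>
    (algebraMap (MvPolynomial (Fin N) (AlgebraicClosure k)) (FractionRing (MvPolynomial (Fin N) (AlgebraicClosure k)))).comp ((mAct (U t)).toRingHom.comp (map a))
  have mapinj : Function.Injective (map a : (MvPolynomial (Fin N) k) →+* (MvPolynomial (Fin N) (AlgebraicClosure k))) := map_injective a ha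
  have Linj : Function.Injective (algebraMap (MvPolynomial (Fin N) (AlgebraicClosure k)) (FractionRing (MvPolynomial (Fin N) (AlgebraicClosure k)))) := IsFractionRing.injective _ _
  have hψ : ∀ t ∈ T, Function.Injective (ψ t) := by
    intro t ht
    refine Linj.comp ((minj _ ?_).comp mapinj)
    have h1 := hU t ht
    exact ht.1.mul ((Matrix.isUnit_nonsing_inv_iff).2 ht.2)
  let ι₀ : (MvPolynomial (Fin N) k) →+* (FractionRing (MvPolynomial (Fin N) (AlgebraicClosure k))) := (algebraMap (MvPolynomial (Fin N) (AlgebraicClosure k)) (FractionRing (MvPolynomial (Fin N) (AlgebraicClosure k)))).comp (map a)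
  have hι : Function.Injective ι₀ := Linj.comp mapinj
  let ι : (FractionRing (MvPolynomial (Fin N) k)) →+* (FractionRing (MvPolynomial (Fin N) (AlgebraicClosure k))) := IsFractionRing.lift hι
  have fix : ∀ t (ht : t ∈ T), ∀ f ∈ s, (IsFractionRing.lift (hψ t ht) : (FractionRing (MvPolynomial (Fin N) k)) →+* (FractionRing (MvPolynomial (Fin N) (AlgebraicClosure k)))) f = ι f := by
    intro t ht f hf
    obtain ⟨hinv, f₁, f₂, h2, hcop, rfl, hd⟩ := hs f hf
    by_cases h1 : f₁ = 0
    · subst h1; simp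
    obtain ⟨c, e1, e2⟩ := aux_semi (ρ g) f₁ f₂ h1 h2 hcop (hinv g)
    have n2 : (ψ t) f₂ ≠ 0 := fun h => h2 ((map_eq_zero_iff _ (hψ t ht)).1 h)
    have n2' : ι₀ f₂ ≠ 0 := fun h => h2 ((map_eq_zero_iff _ hι).1 h)
    simp only [ι, map_div₀, IsFractionRing.lift_algebraMap]
    rw [div_eq_div_iff n2 n2']
    simp only [ψ, ι₀, RingHom.comp_apply]
    rw [← map_mul, ← map_mul]
    congr 1
    apply minj _ ht.2
    have hc : ∀ p, mAct (t • 1 + B) (mAct (U t) p) = mAct (t • 1 + A) p := by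
      intro p
      rw [← AlgHom.comp_apply, mAct_comp, hU t ht]
    have key := aux_key A B hAB t (a c) (map a f₁) (map a f₂)
      (fun h => h1 ((map_eq_zero_iff _ mapinj).1 h))
      (fun h => h2 ((map_eq_zero_iff _ mapinj).1 h))
      (le_trans (add_le_add (aux_degmap _ _) (aux_degmap _ _)) hd)
      (by rw [← aux_map, e1, map_mul, map_C]) (by rw [← aux_map, e2, map_mul, map_C])
    simp only [AlgHom.toRingHom_eq_coe, RingHom.coe_coe, map_mul, hc]
    rw [key]; ring
  have agree : ∀ t (ht : t ∈ T), ∀ f ∈ IntermediateField.adjoin k s,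
      (IsFractionRing.lift (hψ t ht) : (FractionRing (MvPolynomial (Fin N) k)) →+* (FractionRing (MvPolynomial (Fin N) (AlgebraicClosure k)))) f = ι f := by
    intro t ht f hf
    induction hf using IntermediateField.adjoin_induction with
    | mem x hx => exact fix t ht x hx
    | algebraMap x =>
      rw [IsScalarTower.algebraMap_apply k (MvPolynomial (Fin N) k) (FractionRing (MvPolynomial (Fin N) k)), IsFractionRing.lift_algebraMap,
        IsFractionRing.lift_algebraMap]
      simp [ψ, ι₀, mAct, MvPolynomial.algebraMap_eq]
    | add x y _ _ hx hy => rw [map_add, map_add, hx, hy]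
    | inv x _ hx => rw [map_inv₀, map_inv₀, hx]
    | mul x y _ _ hx hy => rw [map_mul, map_mul, hx, hy]
  have finite : ∀ i : Fin N, ∃ Z : Set (FractionRing (MvPolynomial (Fin N) (AlgebraicClosure k))), Z.Finite ∧ ∀ t ∈ T, ψ t (X i) ∈ Z := by
    intro i
    obtain ⟨p, hp, hpx⟩ := aux_alg ρ _ halg (algebraMap (MvPolynomial (Fin N) k) (FractionRing (MvPolynomial (Fin N) k)) (X i))
    let j : IntermediateField.adjoin k s →+* (FractionRing (MvPolynomial (Fin N) (AlgebraicClosure k))) := ι.comp (algebraMap _ (FractionRing (MvPolynomial (Fin N) k)))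
    have hpj : p.map j ≠ 0 := by
      rwa [Ne, Polynomial.map_eq_zero]
    refine ⟨{z | z ∈ (p.map j).roots}, Multiset.finite_toSet _, fun t ht => ?_⟩
    simp only [Set.mem_ofPred_eq]
    rw [Polynomial.mem_roots hpj, Polynomial.IsRoot, Polynomial.eval_map]
    have hj : j = (IsFractionRing.lift (hψ t ht) : (FractionRing (MvPolynomial (Fin N) k)) →+* (FractionRing (MvPolynomial (Fin N) (AlgebraicClosure k)))).comp (algebraMap _ (FractionRing (MvPolynomial (Fin N) k))) := by
      ext x
      exact (agree t ht x x.2).symm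
    rw [hj, ← IsFractionRing.lift_algebraMap (K := (FractionRing (MvPolynomial (Fin N) k))) (hψ t ht), ← Polynomial.hom_eval₂]
    rw [Polynomial.aeval_def] at hpx
    rw [hpx, map_zero]
  choose Z hZ hZT using finite
  obtain ⟨t, ht, t', ht', hne, heq⟩ := hT.exists_ne_map_eq_of_mapsTo
    (f := fun t => fun i => ψ t (X i)) (t := Set.univ.pi Z)
    (fun t ht i _ => hZT i t ht) (Set.Finite.pi' hZ |>.subset (fun x hx i => hx i trivial))
  have hUU : U t = U t' := by
    ext i j
    have h := congrFun heq i
    simp only [ψ, RingHom.comp_apply] at h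
    have h := Linj h
    simp only [AlgHom.toRingHom_eq_coe, RingHom.coe_coe, map_X, mAct, aeval_X] at h
    have h := congrArg (eval (Pi.single j 1)) h
    simpa [Pi.single_apply] using h
  have q1 := hU t ht
  have q2 := hU t' ht'
  rw [← hUU] at q2
  have hU1 : U t = 1 := by
    have h3 : (t - t') • U t = (t - t') • 1 := by
      have := congrArg₂ (· - ·) q1 q2
      simp only [mul_add, mul_smul_comm, mul_one, add_sub_add_right_eq_sub] at this
      rw [sub_smul, sub_smul]; exact this
    exact smul_right_injective _ (sub_ne_zero.2 hne) h3
  rw [hU1, one_mul] at q1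
  have hBA' : B = A := add_left_cancel q1
  have hv : ((ρ g)⁻¹ : GL (Fin N) k).val = (ρ g).val :=
    Matrix.map_injective ha hBA'
  have hr : (ρ g)⁻¹ = ρ g := Units.ext hv
  rw [← map_inv] at hr
  have hgg := hfaithful hr
  have : g ^ 2 = 1 := by
    rw [pow_two]; nth_rewrite 1 [← hgg]; exact inv_mul_cancel g
  have := orderOf_le_of_pow_eq_one (by norm_num) this
  omega

/-- If the finite abelian group `G` is not an elementary abelian `2`-group
(it has an element of order greater than `2`) and `V` is a faithful representation in
nonmodular characteristic, then `γ^r(G,V) ≥ 3`. -/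
theorem stmt15 {k : Type} [Field k] {N : ℕ} {G : Type} [CommGroup G] [Fintype G]
    (hchar : (Fintype.card G : k) ≠ 0) (hG : ∃ g : G, 2 < orderOf g)
    (ρ : G →* GL (Fin N) k) (hfaithful : Function.Injective ρ) :
    3 ≤ gammaR (fun g => ρ g) := by
  refine le_csInf (aux_nonempty ρ) ?_
  rintro d ⟨s, hs, -, halg⟩
  by_contra hd
  refine aux_main hG ρ hfaithful s (fun f hf => ⟨(hs f hf).1, ?_⟩) halg
  obtain ⟨f₁, f₂, h1, h2, h3, h4⟩ := (hs f hf).2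
  exact ⟨f₁, f₂, h1, h2, h3, by omega⟩
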